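/- Let A > 0 and λ ≥ 0, and let P_{X*} be a capacity-achieving input distribution of the amplitude-constrained discrete-time Poisson channel. Then for every x* ∈ supp(P_{X*}), the point mass satisfies P_{X*}({x*}) ≤ e^{-C(A,λ)}. -/

import Mathlib

open MeasureTheory Real Set

noncomputable section

/-- Poisson transition pmf with dark current `lam`:
`P_{Y|X}(y|x) = (x+lam)^y e^{-(x+lam)} / y!` (with the convention `0^0 = 1`). -/
def channelPMF (lam x : ℝ) (y : ℕ) : ℝ :=
  (x + lam) ^ y * Real.exp (-(x + lam)) / (Nat.factorial y)

/-- Output pmf induced by the input distribution `μ`. -/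
def outputPMF (lam : ℝ) (μ : Measure ℝ) (y : ℕ) : ℝ :=
  ∫ x, channelPMF lam x y ∂μ

/-- Kullback–Leibler divergence between pmfs on `ℕ` (natural logarithm). -/
def klDiv (p q : ℕ → ℝ) : ℝ :=
  ∑' y, p y * Real.log (p y / q y)

/-- The function `i(x; μ) = D(P_{Y|X}(·|x) ‖ P_Y^μ)`. -/
def iFun (lam : ℝ) (μ : Measure ℝ) (x : ℝ) : ℝ :=
  klDiv (channelPMF lam x) (outputPMF lam μ)

/-- Mutual information for input distribution `μ`. -/
def mutualInfo (lam : ℝ) (μ : Measure ℝ) : ℝ :=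
  ∫ x, iFun lam μ x ∂μ

/-- Admissible input distributions: probability measures supported in `[0, A]`. -/
def IsInput (A : ℝ) (μ : Measure ℝ) : Prop :=
  IsProbabilityMeasure μ ∧ μ (Set.Icc 0 A)ᶜ = 0

/-- The capacity `C(A, lam)` of the amplitude-constrained Poisson channel. -/
def capacity (A lam : ℝ) : ℝ :=
  sSup (mutualInfo lam '' {μ : Measure ℝ | IsInput A μ})

/-- A capacity-achieving input distribution. -/
def IsCapacityAchieving (A lam : ℝ) (μ : Measure ℝ) : Prop :=
  IsInput A μ ∧ mutualInfo lam μ = capacity A lam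

/-- Topological support of a measure on `ℝ`. -/
def msupport (μ : Measure ℝ) : Set ℝ :=
  {x | ∀ U : Set ℝ, IsOpen U → x ∈ U → 0 < μ U}

lemma channelPMF_nonneg {lam z : ℝ} (hz : 0 ≤ z + lam) (y : ℕ) : 0 ≤ channelPMF lam z y := by
  unfold channelPMF; positivity

lemma hasSum_channelPMF (lam z : ℝ) : HasSum (channelPMF lam z) 1 := by
  have h : HasSum (fun n : ℕ => (z + lam) ^ n / (n.factorial : ℝ)) (Real.exp (z + lam)) := by
    rw [Real.exp_eq_exp_ℝ]
    exact NormedSpace.expSeries_div_hasSum_exp (z + lam)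
  have h2 := h.mul_right (Real.exp (-(z + lam)))
  rw [← Real.exp_add, add_neg_cancel, Real.exp_zero] at h2
  refine h2.congr_fun ?_
  intro y
  unfold channelPMF
  ring

lemma channelPMF_le_one {lam z : ℝ} (hz : 0 ≤ z + lam) (y : ℕ) : channelPMF lam z y ≤ 1 :=
  le_hasSum (hasSum_channelPMF lam z) y fun j _ => channelPMF_nonneg hz j

lemma continuous_channelPMF (lam : ℝ) (y : ℕ) : Continuous fun z => channelPMF lam z y := by
  unfold channelPMF; fun_prop

lemma IsInput.ae_mem {A : ℝ} {μ : Measure ℝ} (h : IsInput A μ) : ∀ᵐ z ∂μ, z ∈ Icc 0 A :=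
  h.2

lemma IsInput.ae_nonneg {A lam : ℝ} (hlam : 0 ≤ lam) {μ : Measure ℝ} (h : IsInput A μ) :
    ∀ᵐ z ∂μ, 0 ≤ z + lam := by
  filter_upwards [h.ae_mem] with z hz using add_nonneg hz.1 hlam

lemma integrable_channelPMF {A lam : ℝ} (hlam : 0 ≤ lam) {μ : Measure ℝ} (h : IsInput A μ)
    (y : ℕ) : Integrable (fun z => channelPMF lam z y) μ := by
  have := h.1
  refine Integrable.of_bound (continuous_channelPMF lam y).aestronglyMeasurable 1 ?_
  filter_upwards [h.ae_nonneg hlam] with z hz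
  rw [Real.norm_of_nonneg (channelPMF_nonneg hz y)]
  exact channelPMF_le_one hz y

lemma outputPMF_nonneg {A lam : ℝ} (hlam : 0 ≤ lam) {μ : Measure ℝ} (h : IsInput A μ)
    (y : ℕ) : 0 ≤ outputPMF lam μ y :=
  integral_nonneg_of_ae <| by
    filter_upwards [h.ae_nonneg hlam] with z hz using channelPMF_nonneg hz y

lemma summable_channelPMF_mul {lam z : ℝ} (hz : 0 ≤ z + lam) {r : ℕ → ℝ} {B : ℝ}
    (hr : ∀ y, |r y| ≤ B) : Summable fun y => channelPMF lam z y * r y := by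
  refine Summable.of_norm_bounded ((hasSum_channelPMF lam z).summable.mul_right B) fun y => ?_
  rw [norm_mul, Real.norm_of_nonneg (channelPMF_nonneg hz y)]
  exact mul_le_mul_of_nonneg_left (hr y) (channelPMF_nonneg hz y)

/-- Fubini for the conditional expectation of a bounded function of the output. -/
lemma hasSum_outputPMF_mul {A lam : ℝ} (hlam : 0 ≤ lam) {μ : Measure ℝ} (h : IsInput A μ)
    {r : ℕ → ℝ} {B : ℝ} (hr : ∀ y, |r y| ≤ B) :
    Integrable (fun z => ∑' y, channelPMF lam z y * r y) μ ∧
    HasSum (fun y => outputPMF lam μ y * r y) (∫ z, ∑' y, channelPMF lam z y * r y ∂μ) := by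
  have := h.1
  have hae := h.ae_nonneg hlam
  constructor
  · refine Integrable.of_bound (C := B) ?_ ?_
    · refine (Measurable.tsum fun y => ?_).aestronglyMeasurable
      exact ((continuous_channelPMF lam y).measurable.mul_const _)
    · filter_upwards [hae] with z hz
      have := tsum_of_norm_bounded ((hasSum_channelPMF lam z).mul_right B)
        (f := fun y => channelPMF lam z y * r y) fun y => by
          rw [norm_mul, Real.norm_of_nonneg (channelPMF_nonneg hz y)]
          exact mul_le_mul_of_nonneg_left (hr y) (channelPMF_nonneg hz y)
      simpa using this
  · have key := hasSum_integral_of_dominated_convergence (μ := μ)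
      (F := fun y z => channelPMF lam z y * r y)
      (f := fun z => ∑' y, channelPMF lam z y * r y)
      (fun y z => channelPMF lam z y * B)
      (fun y => ((continuous_channelPMF lam y).measurable.mul_const _).aestronglyMeasurable)
      (fun y => by
        filter_upwards [hae] with z hz
        rw [norm_mul, Real.norm_of_nonneg (channelPMF_nonneg hz y)]
        exact mul_le_mul_of_nonneg_left (hr y) (channelPMF_nonneg hz y))
      (Filter.Eventually.of_forall fun z => (hasSum_channelPMF lam z).summable.mul_right B)
      (by
        simp_rw [fun z => ((hasSum_channelPMF lam z).mul_right B).tsum_eq]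
        exact integrable_const _)
      (by
        filter_upwards [hae] with z hz using (summable_channelPMF_mul hz hr).hasSum)
    simp only [integral_mul_const] at key
    exact key

lemma hasSum_outputPMF {A lam : ℝ} (hlam : 0 ≤ lam) {μ : Measure ℝ} (h : IsInput A μ) :
    HasSum (outputPMF lam μ) 1 := by
  have := h.1
  have key := (hasSum_outputPMF_mul hlam h (r := fun _ => 1) (B := 1) (by simp)).2
  simpa [fun z => (hasSum_channelPMF lam z).tsum_eq] using key

lemma sub_le_mul_log_div {p q : ℝ} (hp : 0 ≤ p) (hq : 0 < q) : p - q ≤ p * Real.log (p / q) := by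
  rcases hp.eq_or_lt with rfl | hp
  · simp [hq.le]
  · have h := Real.one_sub_inv_le_log_of_pos (div_pos hp hq)
    calc p - q = p * (1 - (p / q)⁻¹) := by field_simp
      _ ≤ _ := mul_le_mul_of_nonneg_left h hp.le

lemma le_outputPMF {A lam b : ℝ} (hlam : 0 ≤ lam) {μ : Measure ℝ} (h : IsInput A μ)
    (hb : 0 ≤ b) (y : ℕ) :
    μ.real {z | b ≤ z + lam} * Real.exp (-(A + lam)) * (b ^ y / y.factorial)
      ≤ outputPMF lam μ y := by
  have := h.1
  have hS : MeasurableSet {z : ℝ | b ≤ z + lam} := measurableSet_le (by fun_prop) (by fun_prop)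
  rw [mul_assoc, ← smul_eq_mul (μ.real _), ← integral_indicator_const _ hS]
  refine integral_mono_ae ((integrable_const _).indicator hS) (integrable_channelPMF hlam h y) ?_
  filter_upwards [h.ae_mem] with z hz
  have hz0 : 0 ≤ z + lam := add_nonneg hz.1 hlam
  by_cases hzb : b ≤ z + lam
  · rw [indicator_of_mem (by exact hzb)]
    unfold channelPMF
    rw [mul_div_assoc', mul_comm (Real.exp _)]
    have := hz.2
    gcongr
  · rw [indicator_of_notMem (by exact hzb)]
    exact channelPMF_nonneg hz0 y

lemma summable_mul_log {lam z b c : ℝ} (hz : 0 < z + lam) (hb : 0 < b) (hc : 0 < c)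
    {q : ℕ → ℝ} (hq : Summable q) (hle : ∀ y, c * (b ^ y / y.factorial) ≤ q y) :
    Summable fun y => channelPMF lam z y * Real.log (channelPMF lam z y / q y) := by
  set a := z + lam with ha
  have hqpos : ∀ y, 0 < q y := fun y => lt_of_lt_of_le (by positivity) (hle y)
  have hppos : ∀ y, 0 < channelPMF lam z y := fun y => by unfold channelPMF; positivity
  have hp := (hasSum_channelPMF lam z).summable
  set L := Real.log (a / b)
  set M := Real.log (1 / c)
  have hy : Summable fun y : ℕ => channelPMF lam z y * (y : ℝ) := by
    refine Summable.of_nonneg_of_le (fun y => mul_nonneg (hppos y).le y.cast_nonneg) (fun y => ?_)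
      ((Real.summable_pow_div_factorial (2 * a)).mul_right (Real.exp (-a)))
    have h2 : (y : ℝ) ≤ 2 ^ y := by exact_mod_cast (Nat.lt_two_pow_self (n := y)).le
    calc channelPMF lam z y * y ≤ channelPMF lam z y * 2 ^ y :=
          mul_le_mul_of_nonneg_left h2 (hppos y).le
      _ = _ := by unfold channelPMF; rw [mul_pow, ← ha]; ring
  have hup : ∀ y, channelPMF lam z y * Real.log (channelPMF lam z y / q y)
      ≤ channelPMF lam z y * (y * |L| + |M|) := fun y => by
    refine mul_le_mul_of_nonneg_left ?_ (hppos y).le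
    calc Real.log (channelPMF lam z y / q y) ≤ Real.log ((a / b) ^ y * (1 / c)) := by
          refine Real.log_le_log (div_pos (hppos y) (hqpos y)) ?_
          rw [div_le_iff₀ (hqpos y)]
          calc channelPMF lam z y ≤ a ^ y / y.factorial := by
                unfold channelPMF
                gcongr
                exact mul_le_of_le_one_right (by positivity) (Real.exp_le_one_iff.2 (by linarith))
            _ = (a / b) ^ y * (1 / c) * (c * (b ^ y / y.factorial)) := by
                rw [div_pow]; field_simp
            _ ≤ _ := mul_le_mul_of_nonneg_left (hle y) (by positivity)
      _ = y * L + M := by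
          rw [Real.log_mul (by positivity) (by positivity), Real.log_pow]
      _ ≤ _ := by gcongr <;> exact le_abs_self _
  have hs : Summable fun y => channelPMF lam z y * (y * |L| + |M|) := by
    refine ((hy.mul_right |L|).add (hp.mul_right |M|)).congr fun y => ?_
    ring
  have hlow := fun y => sub_le_mul_log_div (hppos y).le (hqpos y)
  have h0 : Summable fun y => channelPMF lam z y * Real.log (channelPMF lam z y / q y)
      - (channelPMF lam z y - q y) :=
    Summable.of_nonneg_of_le (fun y => sub_nonneg.2 (hlow y))
      (fun y => sub_le_sub_right (hup y) _) (hs.sub (hp.sub hq))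
  exact (h0.add (hp.sub hq)).congr fun y => by ring

lemma ae_summable_mul_log {A lam : ℝ} (hlam : 0 ≤ lam) {μ : Measure ℝ} (h : IsInput A μ) :
    ∀ᵐ z ∂μ, Summable fun y =>
      channelPMF lam z y * Real.log (channelPMF lam z y / outputPMF lam μ y) := by
  have := h.1
  have hzero : ∀ z, z + lam = 0 → Summable fun y =>
      channelPMF lam z y * Real.log (channelPMF lam z y / outputPMF lam μ y) := fun z hz => by
    refine summable_of_ne_finset_zero (s := {0}) fun y hy => ?_
    have : y ≠ 0 := by simpa using hy
    simp [channelPMF, hz, this]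
  by_cases hb : ∃ n : ℕ, 0 < μ.real {z | 1 / ((n : ℝ) + 1) ≤ z + lam}
  · obtain ⟨n, hn⟩ := hb
    filter_upwards [h.ae_nonneg hlam] with z hz
    rcases hz.eq_or_lt with hz | hz
    · exact hzero z hz.symm
    · exact summable_mul_log hz (b := 1 / ((n : ℝ) + 1)) (by positivity)
        (mul_pos hn (Real.exp_pos _)) (hasSum_outputPMF hlam h).summable
        fun y => le_outputPMF hlam h (by positivity) y
  · push Not at hb
    have hae : ∀ᵐ z ∂μ, ∀ n : ℕ, ¬ 1 / ((n : ℝ) + 1) ≤ z + lam := by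
      rw [ae_all_iff]
      intro n
      have := le_antisymm (hb n) measureReal_nonneg
      rw [measureReal_eq_zero_iff] at this
      simpa [ae_iff] using this
    filter_upwards [h.ae_nonneg hlam, hae] with z hz hz'
    refine hzero z (le_antisymm (not_lt.1 fun hpos => ?_) hz)
    obtain ⟨n, hn⟩ := exists_nat_one_div_lt hpos
    exact hz' n hn.le

lemma measureReal_singleton_mul_le {A lam : ℝ} (hlam : 0 ≤ lam) {μ : Measure ℝ} (h : IsInput A μ)
    (x : ℝ) (y : ℕ) : μ.real {x} * channelPMF lam x y ≤ outputPMF lam μ y := by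
  have hi := integrable_channelPMF hlam h y
  have := setIntegral_le_integral (s := {x}) hi <| by
    filter_upwards [h.ae_nonneg hlam] with z hz using channelPMF_nonneg hz y
  rwa [integral_singleton, smul_eq_mul] at this

/-- Part of the mass of an atom can be split off an input distribution. -/
lemma IsInput.exists_eq_add_dirac {A : ℝ} {μ : Measure ℝ} (h : IsInput A μ) {x t : ℝ}
    (ht : 0 ≤ t) (htx : t ≤ μ.real {x}) (ht1 : t < 1) :
    ∃ ν : Measure ℝ, IsInput A ν ∧
      μ = ENNReal.ofReal (1 - t) • ν + ENNReal.ofReal t • Measure.dirac x := by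
  have := h.1
  set κ : Measure ℝ := μ.restrict {x}ᶜ + ENNReal.ofReal (μ.real {x} - t) • Measure.dirac x with hκ
  have hμ : μ = κ + ENNReal.ofReal t • Measure.dirac x := by
    conv_lhs => rw [← Measure.restrict_compl_add_restrict (μ := μ) (measurableSet_singleton x)]
    rw [hκ, add_assoc, ← add_smul, ← ENNReal.ofReal_add (by linarith) ht, sub_add_cancel,
      ofReal_measureReal, Measure.restrict_singleton]
  have hne : ENNReal.ofReal (1 - t) ≠ 0 := by simpa using ht1
  have hmul : ENNReal.ofReal (1 - t) • (ENNReal.ofReal (1 - t))⁻¹ • κ = κ := by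
    rw [smul_smul, ENNReal.mul_inv_cancel hne ENNReal.ofReal_ne_top, one_smul]
  have hle : κ ≤ μ := by
    conv_rhs => rw [hμ]
    exact Measure.le_add_right le_rfl
  refine ⟨(ENNReal.ofReal (1 - t))⁻¹ • κ, ⟨⟨?_⟩, ?_⟩, by rw [hmul]; exact hμ⟩
  · have h1 : μ univ = κ univ + ENNReal.ofReal t := by
      conv_lhs => rw [hμ]
      simp
    have h2 : κ univ = ENNReal.ofReal (1 - t) := by
      rw [ENNReal.ofReal_sub _ ht, ENNReal.ofReal_one, ← measure_univ (μ := μ), h1,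
        ENNReal.add_sub_cancel_right ENNReal.ofReal_ne_top]
    rw [Measure.smul_apply, h2, smul_eq_mul, ENNReal.inv_mul_cancel hne ENNReal.ofReal_ne_top]
  · have : κ (Icc 0 A)ᶜ = 0 := le_antisymm ((hle _).trans h.2.le) bot_le
    simp [this]

/-- Removing the mass `t` from an atom `x` of a capacity-achieving input bounds `iFun` at `x`
from below up to first order in `t`. -/
lemma capacity_sub_le_iFun {A lam : ℝ} (hlam : 0 ≤ lam) {μ : Measure ℝ}
    (hμ : IsCapacityAchieving A lam μ)
    (hbdd : BddAbove (mutualInfo lam '' {μ : Measure ℝ | IsInput A μ}))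
    (hint : Integrable (iFun lam μ) μ) {x t : ℝ} (hx0 : 0 ≤ x + lam)
    (ht : 0 < t) (htx : t < μ.real {x}) (ht1 : t < 1) :
    capacity A lam - t * ((1 / μ.real {x} - 1) / (1 - t)) ≤ iFun lam μ x := by
  obtain ⟨h, hC⟩ := hμ
  have := h.1
  set m := μ.real {x} with hm
  have hm0 : 0 < m := ht.trans htx
  have hm1 : m ≤ 1 := measureReal_le_one
  obtain ⟨ν, hν, hdec⟩ := h.exists_eq_add_dirac ht.le htx.le ht1
  have := hν.1
  have h1t : 0 < 1 - t := by linarith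
  have hintν : ∀ f : ℝ → ℝ, Integrable f μ → Integrable f ν ∧
      ∫ z, f z ∂μ = (1 - t) * ∫ z, f z ∂ν + t * f x := fun f hf => by
    rw [hdec] at hf
    have h1 := hf.left_of_add_measure
    have h2 := hf.right_of_add_measure
    refine ⟨(integrable_smul_measure (by simpa using ht1) ENNReal.ofReal_ne_top).1 h1, ?_⟩
    conv_lhs => rw [hdec]
    rw [integral_add_measure h1 h2, integral_smul_measure, integral_smul_measure, integral_dirac,
      ENNReal.toReal_ofReal h1t.le, ENNReal.toReal_ofReal ht.le, smul_eq_mul, smul_eq_mul]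
  have hac : ν ≪ μ := by
    rw [hdec]
    refine Measure.AbsolutelyContinuous.add_right ?_ _
    exact Measure.absolutelyContinuous_smul (by simpa using ht1)
  set p := channelPMF lam x with hp
  set q := outputPMF lam μ with hq
  set s := outputPMF lam ν with hs
  have hp0 : ∀ y, 0 ≤ p y := channelPMF_nonneg hx0
  have hq0 : ∀ y, 0 ≤ q y := outputPMF_nonneg hlam h
  have hs0 : ∀ y, 0 ≤ s y := outputPMF_nonneg hlam hν
  have hqs : ∀ y, q y = (1 - t) * s y + t * p y := fun y =>
    (hintν _ (integrable_channelPMF hlam h y)).2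
  have hmp : ∀ y, m * p y ≤ q y := measureReal_singleton_mul_le hlam h x
  set K := 1 / (1 - t / m)
  have htm : 0 < 1 - t / m := by rw [sub_pos, div_lt_one hm0]; exact htx
  have hK : 0 < K := by positivity
  have htp : ∀ y, t * p y ≤ t / m * q y := fun y => by
    calc t * p y = t / m * (m * p y) := by field_simp
      _ ≤ _ := mul_le_mul_of_nonneg_left (hmp y) (by positivity)
  have hqK : ∀ y, q y ≤ K * s y := fun y => by
    have : (1 - t / m) * q y ≤ s y := by nlinarith [hqs y, htp y, hs0 y]
    rw [show K * s y = s y / (1 - t / m) by simp only [K]; ring, le_div_iff₀ htm]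
    linarith
  have hsK : ∀ y, s y ≤ K * q y := fun y => by
    have h1 : t ≤ t / m := by rw [le_div_iff₀ hm0]; nlinarith
    have h2 : (1 - t / m) * s y ≤ q y := by
      nlinarith [hqs y, hp0 y, mul_nonneg (sub_nonneg.2 h1) (hs0 y), mul_nonneg ht.le (hp0 y)]
    rw [show K * q y = q y / (1 - t / m) by simp only [K]; ring, le_div_iff₀ htm]
    linarith
  have hs_pos : ∀ y, 0 < q y → 0 < s y := fun y hy => pos_of_mul_pos_right (hy.trans_le (hqK y)) hK.le
  have hs_zero : ∀ y, q y = 0 → s y = 0 := fun y hy =>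
    le_antisymm (by simpa [hy] using hsK y) (hs0 y)
  set r : ℕ → ℝ := fun y => Real.log (q y / s y) with hr
  have hrB : ∀ y, |r y| ≤ |Real.log K| := fun y => by
    rcases (hq0 y).eq_or_lt with hy | hy
    · simp [hr, ← hy]
    · have hsy := hs_pos y hy
      refine (abs_le.2 ⟨?_, ?_⟩).trans (le_abs_self _)
      · rw [neg_le, hr, ← Real.log_inv, inv_div]
        exact Real.log_le_log (div_pos hsy hy) ((div_le_iff₀ hy).2 (hsK y))
      · exact Real.log_le_log (div_pos hy hsy) ((div_le_iff₀ hsy).2 (hqK y))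
  have hi : iFun lam ν =ᵐ[ν] fun z => iFun lam μ z + ∑' y, channelPMF lam z y * r y := by
    filter_upwards [hac (ae_summable_mul_log hlam h), hν.ae_nonneg hlam] with z hz hz0
    simp only [iFun, klDiv]
    rw [← hz.tsum_add (summable_channelPMF_mul hz0 hrB)]
    refine tsum_congr fun y => ?_
    rw [← mul_add]
    rcases (channelPMF_nonneg hz0 y).eq_or_lt with hpz | hpz
    · simp [← hpz]
    · rcases (hq0 y).eq_or_lt with hy | hy
      · have := hs_zero y hy.symm
        simp only [hr]
        rw [← hq, ← hs, ← hy, this]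
        simp
      · have hsy := hs_pos y hy
        simp only [hr]
        rw [← Real.log_mul (div_pos hpz hy).ne' (div_pos hy hsy).ne', div_mul_div_cancel₀ hy.ne']
  obtain ⟨hFi, hF⟩ := hasSum_outputPMF_mul hlam hν hrB
  have hIν : mutualInfo lam ν
      = ∫ z, iFun lam μ z ∂ν + ∫ z, ∑' y, channelPMF lam z y * r y ∂ν := by
    rw [mutualInfo, integral_congr_ae hi, integral_add (hintν _ hint).1 hFi]
  have hle : mutualInfo lam ν ≤ capacity A lam := le_csSup hbdd ⟨ν, hν, rfl⟩
  have hCeq : capacity A lam = (1 - t) * ∫ z, iFun lam μ z ∂ν + t * iFun lam μ x := by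
    rw [← hC]; exact (hintν _ hint).2
  have hterm : ∀ y, s y - (q y - 2 * t * p y + t ^ 2 / m * p y) / (1 - t) ^ 2 ≤ s y * r y := by
    intro y
    rcases (hq0 y).eq_or_lt with hy | hy
    · have h1 := hs_zero y hy.symm
      have h2 : p y = 0 := by
        have := hqs y
        rw [← hy, h1] at this
        nlinarith [hp0 y]
      simp [← hy, h1, h2]
    · have hsy := hs_pos y hy
      have hlog := Real.one_sub_inv_le_log_of_pos (div_pos hy hsy)
      have h1 : s y * (1 - (q y / s y)⁻¹) ≤ s y * r y := mul_le_mul_of_nonneg_left hlog hsy.le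
      refine le_trans ?_ h1
      have h2 : s y = (q y - t * p y) / (1 - t) := by
        rw [eq_div_iff h1t.ne']; linarith [hqs y]
      have h3 : s y * (1 - (q y / s y)⁻¹) = s y - s y ^ 2 / q y := by
        rw [inv_div]; ring
      rw [h3]
      refine sub_le_sub_left ?_ _
      have h4 : s y ^ 2 / q y = (q y - 2 * t * p y + t ^ 2 * (p y ^ 2 / q y)) / (1 - t) ^ 2 := by
        rw [h2]; field_simp; ring
      rw [h4]
      have h5 : p y ^ 2 / q y ≤ p y / m := by
        rw [div_le_div_iff₀ hy hm0]
        nlinarith [mul_le_mul_of_nonneg_left (hmp y) (hp0 y)]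
      have h6 : t ^ 2 / m * p y = t ^ 2 * (p y / m) := by ring
      rw [h6]
      gcongr
  have hps : HasSum p 1 := hasSum_channelPMF lam x
  have hlow := hasSum_le hterm ((hasSum_outputPMF hlam hν).sub
    ((((hasSum_outputPMF hlam h).sub (hps.mul_left (2 * t))).add
      (hps.mul_left (t ^ 2 / m))).div_const ((1 - t) ^ 2))) hF
  have hrew : (1 - t) * (1 - (1 - 2 * t * 1 + t ^ 2 / m * 1) / (1 - t) ^ 2)
      = - (t * (t * ((1 / m - 1) / (1 - t)))) := by
    field_simp; ring
  have hlow' := mul_le_mul_of_nonneg_left hlow h1t.le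
  rw [hrew] at hlow'
  have hle' := mul_le_mul_of_nonneg_left hle h1t.le
  rw [hIν, mul_add] at hle'
  refine le_of_mul_le_mul_left ?_ ht
  linarith

/-- The optimality condition at an atom of a capacity-achieving input. -/
lemma capacity_le_iFun {A lam : ℝ} (hlam : 0 ≤ lam) {μ : Measure ℝ}
    (hμ : IsCapacityAchieving A lam μ)
    (hbdd : BddAbove (mutualInfo lam '' {μ : Measure ℝ | IsInput A μ}))
    (hint : Integrable (iFun lam μ) μ) {x : ℝ} (hx0 : 0 ≤ x + lam)
    (hx : 0 < μ.real {x}) : capacity A lam ≤ iFun lam μ x := by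
  have hlim : Filter.Tendsto
      (fun t : ℝ => capacity A lam - t * ((1 / μ.real {x} - 1) / (1 - t)))
      (nhdsWithin 0 (Ioi 0)) (nhds (capacity A lam)) := by
    have hc : ContinuousAt
        (fun t : ℝ => capacity A lam - t * ((1 / μ.real {x} - 1) / (1 - t))) 0 := by
      refine continuousAt_const.sub (continuousAt_id.mul (ContinuousAt.div ?_ ?_ (by simp)))
        <;> fun_prop
    simpa using hc.tendsto.mono_left nhdsWithin_le_nhds
  refine le_of_tendsto hlim ?_
  filter_upwards [Ioo_mem_nhdsGT hx, Ioo_mem_nhdsGT one_pos] with t ht ht1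
  exact capacity_sub_le_iFun hlam hμ hbdd hint hx0 ht.1 ht.2 ht1.2

lemma iFun_le_neg_log {A lam : ℝ} (hlam : 0 ≤ lam) {μ : Measure ℝ} (h : IsInput A μ) {x : ℝ}
    (hx0 : 0 ≤ x + lam) (hx : 0 < μ.real {x}) : iFun lam μ x ≤ -Real.log (μ.real {x}) := by
  have := h.1
  have hm1 : μ.real {x} ≤ 1 := measureReal_le_one
  unfold iFun klDiv
  by_cases hsum : Summable fun y =>
      channelPMF lam x y * Real.log (channelPMF lam x y / outputPMF lam μ y)
  · have hc := (hasSum_channelPMF lam x).mul_right (-Real.log (μ.real {x}))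
    rw [one_mul] at hc
    refine hasSum_le (fun y => ?_) hsum.hasSum hc
    rcases (channelPMF_nonneg hx0 y).eq_or_lt with hp | hp
    · simp [← hp]
    · refine mul_le_mul_of_nonneg_left ?_ hp.le
      have hle := measureReal_singleton_mul_le hlam h x y
      have hq := (mul_pos hx hp).trans_le hle
      rw [← Real.log_inv]
      refine Real.log_le_log (div_pos hp hq) ?_
      rwa [div_le_iff₀ hq, ← div_eq_inv_mul, le_div_iff₀ hx, mul_comm]
  · rw [tsum_eq_zero_of_not_summable hsum]
    exact neg_nonneg.2 (Real.log_nonpos hx.le hm1)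

/-- Every point mass of the capacity-achieving input is at most `e^{-C(A,lam)}`. -/
theorem point_mass_upper_bound (A lam : ℝ) (hA : 0 < A) (hlam : 0 ≤ lam)
    (μ : Measure ℝ) (hμ : IsCapacityAchieving A lam μ)
    (x : ℝ) (hx : x ∈ msupport μ) :
    μ {x} ≤ ENNReal.ofReal (Real.exp (-(capacity A lam))) := by
  have h := hμ.1
  have := h.1
  rw [← ofReal_measureReal]
  refine ENNReal.ofReal_le_ofReal ?_
  rcases (measureReal_nonneg (μ := μ) (s := {x})).eq_or_lt with hm | hm
  · rw [← hm]; positivity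
  have htriv : capacity A lam = 0 → μ.real {x} ≤ Real.exp (-(capacity A lam)) := fun hC => by
    rw [hC, neg_zero, Real.exp_zero]; exact measureReal_le_one
  by_cases hbdd : BddAbove (mutualInfo lam '' {μ : Measure ℝ | IsInput A μ})
  swap
  · exact htriv (Real.sSup_of_not_bddAbove hbdd)
  by_cases hint : Integrable (iFun lam μ) μ
  swap
  · exact htriv (hμ.2 ▸ integral_undef hint)
  have hxA : x ∈ Icc 0 A := by
    by_contra hxA
    have : μ {x} = 0 := measure_mono_null (singleton_subset_iff.2 hxA) h.2
    simp [Measure.real, this] at hm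
  have hx0 : 0 ≤ x + lam := add_nonneg hxA.1 hlam
  have hle := (capacity_le_iFun hlam hμ hbdd hint hx0 hm).trans (iFun_le_neg_log hlam h hx0 hm)
  rw [← Real.log_le_iff_le_exp hm]
  linarith
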